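/- Let V be a finite-dimensional real inner product space and Φ a reduced crystallographic root system in V with Weyl group W, positive system Φ⁺ and closed positive Weyl chamber C̄⁺. Let α ∈ Φ⁺ be a root such that ⟨ν, α⟩ > 0 for every nonzero ν ∈ C̄⁺ (this holds when Φ is irreducible and α is the highest root), and let s_α ∈ W be the reflection through the hyperplane perpendicular to α. Let a ∈ V satisfy ⟨w(a), β⟩ ≠ 0 for every w ∈ W and every β ∈ Φ. Then for every nonzero χ ∈ C̄⁺ there exists w ∈ W such that ⟨χ, w(a)⟩ and ⟨s_α(χ), w(a)⟩ have opposite signs, i.e. ⟨χ, w(a)⟩ · ⟨s_α(χ), w(a)⟩ < 0. -/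

import Mathlib

open RealInnerProductSpace


lemma wcs_dihedral (S : ℝ → ℝ → ℝ → Prop) (n : ℤ) (hn1 : 1 ≤ n) (hn3 : n ≤ 3)
    (hs : ∀ A B F, S A B F → S (-A) (B - n * A) (F - A))
    (ht : ∀ A B F, S A B F → S (A - B) (-B) F)
    (hA : ∀ A B F, S A B F → A ≠ 0) (hB : ∀ A B F, S A B F → B ≠ 0)
    (hF : ∀ A B F, S A B F → 0 ≤ F * (F - A))
    (u b : ℝ) (h : S u b 0) (hu : u < 0) : u - b < 0 := by
  by_contra hcon
  have hb : b < u := by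
    have h1 := hA _ _ _ (ht _ _ _ h)
    rcases lt_trichotomy (u - b) 0 with h2 | h2 | h2
    · exact absurd h2 hcon
    · exact absurd h2 h1
    · linarith
  have h1 := ht _ _ _ (hs _ _ _ h)
  have h2 := ht _ _ _ (hs _ _ _ (ht _ _ _ h))
  have f1 := hF _ _ _ h1
  have f2 := hF _ _ _ h2
  have b1 := hB _ _ _ h1
  have b2 := hB _ _ _ h2
  have pos : ∀ x y : ℝ, 0 < x → 0 ≤ x * y → 0 ≤ y := fun x y hx h =>
    nonneg_of_mul_nonneg_right h hx
  have neg : ∀ x y : ℝ, x < 0 → 0 ≤ x * y → y ≤ 0 := fun x y hx h => by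
    by_contra h'
    push Not at h'
    nlinarith
  have g1 := pos _ _ (by linarith) f1
  have g2 := neg _ _ (by linarith) f2
  have hn : n = 1 ∨ n = 2 ∨ n = 3 := by omega
  rcases hn with rfl | rfl | rfl
  · push_cast at *
    linarith
  · push_cast at *
    apply b1
    linarith
  · push_cast at *
    have h3 := ht _ _ _ (hs _ _ _ h1)
    have h4 := ht _ _ _ (hs _ _ _ h2)
    have f3 := hF _ _ _ h3
    have f4 := hF _ _ _ h4
    have c1 : b - 3 * u ≠ 0 := fun h => b1 (by linarith)
    have c2 : 2 * b - 3 * u ≠ 0 := fun h => b2 (by linarith)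
    have d1 : 0 < b - 3 * u := lt_of_le_of_ne (by linarith) c1.symm
    have d2 : 2 * b - 3 * u < 0 := lt_of_le_of_ne (by linarith) c2
    have g3 := pos _ _ (by linarith) f3
    have g4 := neg _ _ (by linarith) f4
    apply hA _ _ _ h1
    linarith

lemma wcs_core
    {V : Type*} [NormedAddCommGroup V] [InnerProductSpace ℝ V]
    (Φ : Set V) (hΦ0 : (0 : V) ∉ Φ)
    (hΦspan : Submodule.span ℝ Φ = ⊤)
    (hΦint : ∀ α ∈ Φ, ∀ β ∈ Φ, ∃ z : ℤ, 2 * ⟪β, α⟫ / ⟪α, α⟫ = (z : ℝ))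
    (v₀ : V)
    (α : V) (hαΦ : α ∈ Φ)
    (hαdom : ∀ ν : V, (∀ β ∈ Φ, 0 < ⟪β, v₀⟫ → 0 ≤ ⟪ν, β⟫) → ν ≠ 0 → 0 < ⟪ν, α⟫)
    (X : Finset V) (hXne : X.Nonempty)
    (hXr : ∀ x ∈ X, ∀ β ∈ Φ, x - (2 * ⟪x, β⟫ / ⟪β, β⟫) • β ∈ X)
    (hX : ∀ x ∈ X, ∀ β ∈ Φ, ⟪x, β⟫ ≠ 0)
    (χ : V) (hχ : ∀ β ∈ Φ, 0 < ⟪β, v₀⟫ → 0 ≤ ⟪χ, β⟫) (hχ0 : χ ≠ 0)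
    (hno : ∀ x ∈ X, 0 ≤ ⟪χ, x⟫ * ⟪χ, x - (2 * ⟪x, α⟫ / ⟪α, α⟫) • α⟫) : False := by
  classical
  have hnn : ∀ β ∈ Φ, 0 < ⟪β, β⟫ := fun β hβ => by
    apply real_inner_self_pos.2
    rintro rfl
    exact hΦ0 hβ
  have hχα := hαdom χ hχ hχ0
  have hαα := hnn α hαΦ
  -- reflections
  have r1 : ∀ β ∈ Φ, ∀ x y : V, ⟪x - (2 * ⟪x, β⟫ / ⟪β, β⟫) • β, y⟫
      = ⟪x, y⟫ - 2 * ⟪x, β⟫ / ⟪β, β⟫ * ⟪β, y⟫ := fun β hβ x y => by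
    rw [inner_sub_left, real_inner_smul_left]
  have r2 : ∀ β ∈ Φ, ∀ x : V, ⟪x - (2 * ⟪x, β⟫ / ⟪β, β⟫) • β, β⟫ = - ⟪x, β⟫ := fun β hβ x => by
    rw [r1 β hβ]
    have := (hnn β hβ).ne'
    field_simp
    ring
  have r3 : ∀ β ∈ Φ, ∀ x : V, ⟪χ, x - (2 * ⟪x, β⟫ / ⟪β, β⟫) • β⟫
      = ⟪χ, x⟫ - 2 * ⟪x, β⟫ / ⟪β, β⟫ * ⟪χ, β⟫ := fun β hβ x => by
    rw [inner_sub_right, real_inner_smul_right]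
  have r4 : ∀ β ∈ Φ, ∀ x : V, (x - (2 * ⟪x, β⟫ / ⟪β, β⟫) • β) -
      (2 * ⟪x - (2 * ⟪x, β⟫ / ⟪β, β⟫) • β, β⟫ / ⟪β, β⟫) • β = x := fun β hβ x => by
    rw [r2 β hβ, mul_neg, neg_div, neg_smul]
    abel
  -- sum over invariant sets
  have sum0 : ∀ β ∈ Φ, ∀ U : Finset V, (∀ x ∈ U, x - (2 * ⟪x, β⟫ / ⟪β, β⟫) • β ∈ U) →
      ∑ x ∈ U, ⟪x, β⟫ = 0 := by
    intro β hβ U hU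
    refine Finset.sum_involution (fun x _ => x - (2 * ⟪x, β⟫ / ⟪β, β⟫) • β) ?_ ?_ ?_ ?_
    · intro x hx
      rw [r2 β hβ]
      ring
    · intro x hx h0 h
      have := r2 β hβ x
      rw [h] at this
      apply h0
      linarith
    · intro x hx
      exact hU x hx
    · intro x hx
      exact r4 β hβ x
  have sumpos : ∀ β ∈ Φ, ∀ U : Finset V,
      (∀ x ∈ U, ⟪x, β⟫ < 0 → x - (2 * ⟪x, β⟫ / ⟪β, β⟫) • β ∈ U) →
      0 ≤ ∑ x ∈ U, ⟪x, β⟫ := by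
    intro β hβ U hU
    rw [← Finset.sum_filter_add_sum_filter_not U
      (fun x => x - (2 * ⟪x, β⟫ / ⟪β, β⟫) • β ∈ U)]
    rw [sum0 β hβ (U.filter _), zero_add]
    · apply Finset.sum_nonneg
      intro x hx
      rw [Finset.mem_filter] at hx
      by_contra h
      exact hx.2 (hU x hx.1 (not_le.1 h))
    · intro x hx
      rw [Finset.mem_filter] at hx ⊢
      refine ⟨hx.2, ?_⟩
      rw [r4 β hβ]
      exact hx.1
  have sgn : ∀ t : ℝ, ∀ β ∈ Φ, t < 0 → 2 * t / ⟪β, β⟫ < 0 := fun t β hβ ht =>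
    div_neg_of_neg_of_pos (by linarith) (hnn β hβ)
  have sgn' : ∀ t : ℝ, ∀ β ∈ Φ, 2 * t / ⟪β, β⟫ < 0 → t < 0 := fun t β hβ ht => by
    by_contra h
    push Not at h
    have : 0 ≤ 2 * t / ⟪β, β⟫ := div_nonneg (by linarith) (hnn β hβ).le
    linarith
  -- key sign lemma
  have key : ∀ γ ∈ Φ, ⟪χ, γ⟫ = 0 → ∀ y ∈ X, ⟪χ, y⟫ = 0 → ⟪y, α⟫ < 0 →
      ⟪y - (2 * ⟪y, γ⟫ / ⟪γ, γ⟫) • γ, α⟫ < 0 := by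
    intro γ hγ hχγ y hy hy0 hyα
    by_cases hga : ⟪γ, α⟫ = 0
    · rw [r1 γ hγ, hga]
      linarith
    have hγγ := hnn γ hγ
    obtain ⟨z1, hz1⟩ := hΦint γ hγ α hαΦ
    obtain ⟨z2, hz2⟩ := hΦint α hαΦ γ hγ
    have hsym : ⟪α, γ⟫ = ⟪γ, α⟫ := real_inner_comm _ _
    have hprod : ((z1 * z2 : ℤ) : ℝ) = 4 * ⟪γ, α⟫ ^ 2 / (⟪γ, γ⟫ * ⟪α, α⟫) := by
      push_cast
      rw [← hz1, ← hz2, hsym]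
      field_simp
      ring
    have hn1 : 1 ≤ z1 * z2 := by
      have : (0 : ℝ) < ((z1 * z2 : ℤ) : ℝ) := by
        rw [hprod]
        positivity
      have : 0 < z1 * z2 := by exact_mod_cast this
      omega
    have hn3 : z1 * z2 ≤ 3 := by
      have : ((z1 * z2 : ℤ) : ℝ) < 4 := by
        rw [hprod, div_lt_iff₀ (by positivity)]
        have hw : α - (⟪γ, α⟫ / ⟪γ, γ⟫) • γ ≠ 0 := by
          intro h
          have h1 : ⟪χ, α - (⟪γ, α⟫ / ⟪γ, γ⟫) • γ⟫ = 0 := by rw [h, inner_zero_right]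
          rw [inner_sub_right, real_inner_smul_right, hχγ] at h1
          linarith
        have h2 := real_inner_self_pos.2 hw
        rw [inner_sub_left, inner_sub_right, inner_sub_right, real_inner_smul_left,
          real_inner_smul_left, real_inner_smul_right, real_inner_smul_right, hsym] at h2
        have h3 : 0 < (⟪α, α⟫ - ⟪γ, α⟫ ^ 2 / ⟪γ, γ⟫) := by
          convert h2 using 1
          field_simp
          ring
        have h4 : ⟪γ, α⟫ ^ 2 / ⟪γ, γ⟫ < ⟪α, α⟫ := by linarith
        rw [div_lt_iff₀ hγγ] at h4
        linarith
      have : z1 * z2 < 4 := by exact_mod_cast this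
      omega
    have hkpos : 0 < 2 * ⟪χ, α⟫ / ⟪α, α⟫ := by positivity
    have main := wcs_dihedral (fun A B F => ∃ x ∈ X, A = ⟪x, α⟫ ∧
        B = 2 * ⟪x, γ⟫ / ⟪γ, γ⟫ * ⟪γ, α⟫ ∧ F * (2 * ⟪χ, α⟫ / ⟪α, α⟫) = ⟪χ, x⟫)
      (z1 * z2) hn1 hn3 ?_ ?_ ?_ ?_ ?_ ⟪y, α⟫ (2 * ⟪y, γ⟫ / ⟪γ, γ⟫ * ⟪γ, α⟫)
      ⟨y, hy, rfl, rfl, by rw [hy0, zero_mul]⟩ hyα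
    · rw [r1 γ hγ]
      exact main
    · rintro A B F ⟨x, hx, rfl, rfl, hF⟩
      refine ⟨_, hXr x hx α hαΦ, (r2 α hαΦ x).symm, ?_, ?_⟩
      · rw [r1 α hαΦ, hprod, hsym]
        field_simp
        ring
      · rw [r3 α hαΦ, ← hF]
        field_simp
    · rintro A B F ⟨x, hx, rfl, rfl, hF⟩
      refine ⟨_, hXr x hx γ hγ, (r1 γ hγ x α).symm, ?_, ?_⟩
      · rw [r2 γ hγ]
        ring
      · rw [r3 γ hγ, hχγ, hF]
        ring
    · rintro A B F ⟨x, hx, rfl, rfl, hF⟩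
      exact hX x hx α hαΦ
    · rintro A B F ⟨x, hx, rfl, rfl, hF⟩
      have := hX x hx γ hγ
      positivity
    · rintro A B F ⟨x, hx, rfl, rfl, hF⟩
      have h1 := hno x hx
      rw [r3 α hαΦ, ← hF] at h1
      have h2 : F * (2 * ⟪χ, α⟫ / ⟪α, α⟫) * (F * (2 * ⟪χ, α⟫ / ⟪α, α⟫) -
          2 * ⟪x, α⟫ / ⟪α, α⟫ * ⟪χ, α⟫) = (F * (F - ⟪x, α⟫)) * (2 * ⟪χ, α⟫ / ⟪α, α⟫) ^ 2 := by
        ring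
      rw [h2] at h1
      exact nonneg_of_mul_nonneg_left h1 (by positivity)
  -- some element is positive
  have hpos : ∃ x ∈ X, 0 < ⟪χ, x⟫ := by
    by_contra hcon
    push Not at hcon
    have hs : ∑ x ∈ X, x = 0 := by
      have : ∀ v ∈ Submodule.span ℝ Φ, ⟪∑ x ∈ X, x, v⟫ = 0 := by
        intro v hv
        induction hv using Submodule.span_induction with
        | mem β hβ =>
          rw [sum_inner]
          exact sum0 β hβ X (fun x hx => hXr x hx β hβ)
        | zero => exact inner_zero_right _
        | add x y _ _ h1 h2 => rw [inner_add_right, h1, h2, add_zero]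
        | smul c x _ h => rw [real_inner_smul_right, h, mul_zero]
      exact inner_self_eq_zero.1 (this _ (by rw [hΦspan]; trivial))
    have hs' : ∑ x ∈ X, ⟪χ, x⟫ = 0 := by rw [← inner_sum, hs, inner_zero_right]
    have hz := (Finset.sum_eq_zero_iff_of_nonpos hcon).1 hs'
    obtain ⟨x, hx⟩ := hXne
    have h1 := hz x hx
    have h2 := hz _ (hXr x hx α hαΦ)
    rw [r3 α hαΦ, h1] at h2
    have := hX x hx α hαΦ
    have h3 : 2 * ⟪x, α⟫ / ⟪α, α⟫ * ⟪χ, α⟫ ≠ 0 := by positivity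
    apply h3
    linarith
  let U := X.filter (fun x => 0 < ⟪χ, x⟫ ∨ (⟪χ, x⟫ = 0 ∧ ⟪x, α⟫ < 0))
  have hU : ∀ x, x ∈ U ↔ x ∈ X ∧ (0 < ⟪χ, x⟫ ∨ (⟪χ, x⟫ = 0 ∧ ⟪x, α⟫ < 0)) := fun x =>
    Finset.mem_filter
  have hUα : ⟪∑ x ∈ U, x, α⟫ = 0 := by
    rw [sum_inner]
    apply sum0 α hαΦ
    intro x hx
    rw [hU] at hx ⊢
    refine ⟨hXr x hx.1 α hαΦ, ?_⟩
    have h1 := hno x hx.1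
    rw [r2 α hαΦ]
    rcases hx.2 with h | ⟨h, h'⟩
    · have h2 := nonneg_of_mul_nonneg_right h1 h
      rcases h2.lt_or_eq with h3 | h3
      · exact Or.inl h3
      · right
        refine ⟨h3.symm, ?_⟩
        rw [r3 α hαΦ] at h3
        by_contra h4
        have h5 : ⟪x, α⟫ ≤ 0 := by linarith
        have h6 : 2 * ⟪x, α⟫ / ⟪α, α⟫ ≤ 0 := div_nonpos_of_nonpos_of_nonneg (by linarith) hαα.le
        nlinarith
    · left
      rw [r3 α hαΦ, h]
      have := sgn _ α hαΦ h'
      nlinarith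
  have hdom := hαdom (∑ x ∈ U, x) ?_ ?_
  · rw [hUα] at hdom
    exact lt_irrefl _ hdom
  · intro β hβ hβ0
    rw [sum_inner]
    apply sumpos β hβ
    intro x hx hneg
    rw [hU] at hx ⊢
    refine ⟨hXr x hx.1 β hβ, ?_⟩
    have h1 := hχ β hβ hβ0
    have h2 := sgn _ β hβ hneg
    rcases hx.2 with h | ⟨h, h'⟩
    · left
      rw [r3 β hβ]
      nlinarith
    · rcases h1.lt_or_eq with h3 | h3
      · left
        rw [r3 β hβ]
        nlinarith
      · right
        refine ⟨?_, key β hβ h3.symm x hx.1 h h'⟩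
        rw [r3 β hβ, ← h3, h]
        ring
  · intro h0
    have h1 : ∑ x ∈ U, ⟪χ, x⟫ = 0 := by rw [← inner_sum, h0, inner_zero_right]
    have h2 : 0 < ∑ x ∈ U, ⟪χ, x⟫ := by
      obtain ⟨x, hx, hx0⟩ := hpos
      apply Finset.sum_pos'
      · intro y hy
        rw [hU] at hy
        rcases hy.2 with h | h
        · exact h.le
        · exact h.1.ge
      · exact ⟨x, (hU x).2 ⟨hx, Or.inl hx0⟩, hx0⟩
    linarith

/-- Proposition (rootprop): Let `Φ` be a reduced crystallographic root system in a
finite-dimensional real inner product space `V`, with Weyl group `W` (the subgroup of the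
group of linear isometries of `V` generated by the reflections in the roots), positive
system determined by a regular vector `v₀`, and closed positive Weyl chamber.  Let `α` be
a positive root with `⟪ν, α⟫ > 0` for every nonzero `ν` in the closed positive chamber,
and let `a ∈ V` satisfy `⟪w a, β⟫ ≠ 0` for all `w ∈ W`, `β ∈ Φ`.  Then for every nonzero
`χ` in the closed positive chamber there is `w ∈ W` such that `⟪χ, w a⟫` and
`⟪s_α χ, w a⟫` have opposite signs. -/
theorem weyl_chamber_separation
    {V : Type*} [NormedAddCommGroup V] [InnerProductSpace ℝ V] [FiniteDimensional ℝ V]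
    (Φ : Set V) (hΦfin : Φ.Finite) (hΦ0 : (0 : V) ∉ Φ)
    (hΦspan : Submodule.span ℝ Φ = ⊤)
    (hΦrefl : ∀ α ∈ Φ, ∀ β ∈ Φ, β - (2 * ⟪β, α⟫ / ⟪α, α⟫) • α ∈ Φ)
    (hΦint : ∀ α ∈ Φ, ∀ β ∈ Φ, ∃ z : ℤ, 2 * ⟪β, α⟫ / ⟪α, α⟫ = (z : ℝ))
    (hΦred : ∀ α ∈ Φ, ∀ t : ℝ, t • α ∈ Φ → t = 1 ∨ t = -1)
    (W : Subgroup (V ≃ₗᵢ[ℝ] V))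
    (hW : W = Subgroup.closure
      {g : V ≃ₗᵢ[ℝ] V | ∃ α ∈ Φ, ∀ x : V, g x = x - (2 * ⟪x, α⟫ / ⟪α, α⟫) • α})
    (v₀ : V) (hv₀ : ∀ β ∈ Φ, ⟪β, v₀⟫ ≠ 0)
    (α : V) (hαΦ : α ∈ Φ) (hαpos : 0 < ⟪α, v₀⟫)
    (hαdom : ∀ ν : V, (∀ β ∈ Φ, 0 < ⟪β, v₀⟫ → 0 ≤ ⟪ν, β⟫) → ν ≠ 0 → 0 < ⟪ν, α⟫)
    (a : V) (ha : ∀ w ∈ W, ∀ β ∈ Φ, ⟪(w : V ≃ₗᵢ[ℝ] V) a, β⟫ ≠ 0)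
    (χ : V) (hχ : ∀ β ∈ Φ, 0 < ⟪β, v₀⟫ → 0 ≤ ⟪χ, β⟫) (hχ0 : χ ≠ 0) :
    ∃ w ∈ W, ⟪χ, (w : V ≃ₗᵢ[ℝ] V) a⟫ *
        ⟪χ - (2 * ⟪χ, α⟫ / ⟪α, α⟫) • α, (w : V ≃ₗᵢ[ℝ] V) a⟫ < 0 := by
  classical
  by_contra hcon
  push Not at hcon
  have hnn : ∀ β ∈ Φ, 0 < ⟪β, β⟫ := fun β hβ => by
    apply real_inner_self_pos.2
    rintro rfl
    exact hΦ0 hβ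
  have hrefl : ∀ β ∈ Φ, ∃ g ∈ W, ∀ x : V, g x = x - (2 * ⟪x, β⟫ / ⟪β, β⟫) • β := by
    intro β hβ
    have hg : ∀ x : V, (Submodule.reflection (Submodule.span ℝ {β})ᗮ) x
        = x - (2 * ⟪x, β⟫ / ⟪β, β⟫) • β := by
      intro x
      rw [Submodule.reflection_orthogonal_apply, Submodule.reflection_singleton_apply,
        real_inner_comm, RCLike.ofReal_real_eq_id, id_eq, ← real_inner_self_eq_norm_sq, neg_sub, ← Nat.cast_smul_eq_nsmul ℝ,
        smul_smul]
      simp [mul_div_assoc]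
    refine ⟨Submodule.reflection (Submodule.span ℝ {β})ᗮ, ?_, hg⟩
    rw [hW]
    exact Subgroup.subset_closure ⟨β, hβ, hg⟩
  have hperm : ∀ w ∈ W, ∀ β ∈ Φ, w β ∈ Φ := by
    intro w hw
    rw [hW] at hw
    induction hw using Subgroup.closure_induction with
    | mem g hg =>
      obtain ⟨γ, hγ, hg⟩ := hg
      intro β hβ
      rw [hg]
      exact hΦrefl γ hγ β hβ
    | one => exact fun β hβ => hβ
    | mul x y _ _ hx hy => exact fun β hβ => hx _ (hy β hβ)
    | inv x _ hx =>
      intro β hβ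
      have hmaps : Set.MapsTo x Φ Φ := hx
      have hsurj := (hΦfin.injOn_iff_bijOn_of_mapsTo hmaps).1 x.injective.injOn
      obtain ⟨δ, hδ, h⟩ := hsurj.surjOn hβ
      rw [← h]
      have : x⁻¹ (x δ) = δ := x.symm_apply_apply δ
      rw [this]
      exact hδ
  have hfin : Finite W := by
    have : Finite Φ := hΦfin
    apply Finite.of_injective (fun (w : W) (β : Φ) => (⟨w.1 β.1, hperm w.1 w.2 β.1 β.2⟩ : Φ))
    intro w w' h
    apply Subtype.ext
    apply LinearIsometryEquiv.toLinearEquiv_injective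
    apply LinearEquiv.toLinearMap_injective
    apply LinearMap.ext_on hΦspan
    intro β hβ
    exact congrArg Subtype.val (congrFun h ⟨β, hβ⟩)
  have hXf : (Set.range (fun w : W => (w : V ≃ₗᵢ[ℝ] V) a)).Finite := Set.finite_range _
  have hmem : ∀ x, x ∈ hXf.toFinset ↔ ∃ w ∈ W, w a = x := by
    intro x
    simp
  refine wcs_core Φ hΦ0 hΦspan hΦint v₀ α hαΦ hαdom hXf.toFinset
    ⟨a, (hmem a).2 ⟨1, W.one_mem, rfl⟩⟩ ?_ ?_ χ hχ hχ0 ?_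
  · intro x hx β hβ
    rw [hmem] at hx ⊢
    obtain ⟨w, hw, rfl⟩ := hx
    obtain ⟨g, hg, hgx⟩ := hrefl β hβ
    exact ⟨g * w, W.mul_mem hg hw, hgx _⟩
  · intro x hx β hβ
    rw [hmem] at hx
    obtain ⟨w, hw, rfl⟩ := hx
    exact ha w hw β hβ
  · intro x hx
    rw [hmem] at hx
    obtain ⟨w, hw, rfl⟩ := hx
    have h := hcon w hw
    suffices hs : ⟪χ, w a - (2 * ⟪w a, α⟫ / ⟪α, α⟫) • α⟫ =
        ⟪χ - (2 * ⟪χ, α⟫ / ⟪α, α⟫) • α, w a⟫ by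
      rw [hs]
      exact h
    rw [inner_sub_left, inner_sub_right, real_inner_smul_left, real_inner_smul_right,
      real_inner_comm α (w a)]
    ring
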